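/- Let d ≥ 1 and σ > 0. The spectral gap of the locally balanced ideal Metropolis–Hastings kernel P_∞ satisfies γ(P_∞) ≤ min{ (3/2)·σ²/(2+σ²), (1 + σ⁴/(2+σ²)²)^{−d/2} }. -/

import Mathlib

open MeasureTheory ENNReal

noncomputable section

/-- `ℝ^d` with the Euclidean norm and Lebesgue measure. -/
abbrev Ed (d : ℕ) := EuclideanSpace ℝ (Fin d)

variable {d : ℕ}

/-- The standard Gaussian density on `ℝ^d`. -/
def stdGauss (d : ℕ) (x : Ed d) : ℝ :=
  (2 * Real.pi) ^ (-(d : ℝ) / 2) * Real.exp (-‖x‖ ^ 2 / 2)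

/-- The locally balanced reweighted proposal density: the density at `y` of
`N(2x/(2+σ²), (2σ²/(2+σ²))·I_d)`. -/
def lbProp (σ : ℝ) (x y : Ed d) : ℝ :=
  (2 * Real.pi * (2 * σ ^ 2 / (2 + σ ^ 2))) ^ (-(d : ℝ) / 2) *
    Real.exp (-‖y - (2 / (2 + σ ^ 2)) • x‖ ^ 2 / (2 * (2 * σ ^ 2 / (2 + σ ^ 2))))

/-- The acceptance probability `α(x,y) = min{1, π(y) g(y,x)/(π(x) g(x,y))}`. -/
def lbAcc (d : ℕ) (σ : ℝ) (x y : Ed d) : ℝ :=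
  min 1 (stdGauss d y * lbProp σ y x / (stdGauss d x * lbProp σ x y))

/-- The probability measure with standard Gaussian density. -/
def piMeasure (d : ℕ) : Measure (Ed d) :=
  volume.withDensity fun x => ENNReal.ofReal (stdGauss d x)

/-- The Dirichlet form of the locally balanced ideal kernel `P_∞`:
`ℰ(P_∞,f) = (1/2)∫∫ (f(x) - f(y))² α(x,y) g(x,y) π(x) dy dx`. -/
def lbDirichlet (d : ℕ) (σ : ℝ) (f : Ed d → ℝ) : ℝ≥0∞ :=
  (1 / 2 : ℝ≥0∞) * ∫⁻ x, ∫⁻ y,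
    ENNReal.ofReal ((f x - f y) ^ 2 * lbAcc d σ x y * lbProp σ x y * stdGauss d x)

/-- The spectral gap `γ(P_∞)` of the locally balanced ideal kernel. -/
def lbGap (d : ℕ) (σ : ℝ) : ℝ≥0∞ :=
  ⨅ (f : Ed d → ℝ) (_ : Measurable f ∧
      0 < (∫⁻ x, ENNReal.ofReal (f x ^ 2) ∂piMeasure d) ∧
      (∫⁻ x, ENNReal.ofReal (f x ^ 2) ∂piMeasure d) < ∞ ∧
      (∫ x, f x ∂piMeasure d) = 0),
    lbDirichlet d σ f / ∫⁻ x, ENNReal.ofReal (f x ^ 2) ∂piMeasure d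

/-- The conductance `Φ(P_∞)` of the locally balanced ideal kernel. -/
def lbConductance (d : ℕ) (σ : ℝ) : ℝ≥0∞ :=
  ⨅ (A : Set (Ed d)) (_ : MeasurableSet A ∧
      0 < (∫⁻ x in A, ENNReal.ofReal (stdGauss d x)) ∧
      (∫⁻ x in A, ENNReal.ofReal (stdGauss d x)) ≤ 1 / 2),
    (∫⁻ x in A, ∫⁻ y in Aᶜ, ENNReal.ofReal (lbAcc d σ x y * lbProp σ x y * stdGauss d x)) /
      ∫⁻ x in A, ENNReal.ofReal (stdGauss d x)

section SpectralGap

open Real Filter Topology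

lemma stdGauss_pos (d : ℕ) (x : Ed d) : 0 < stdGauss d x := by
  unfold stdGauss; positivity

lemma continuous_stdGauss (d : ℕ) : Continuous (stdGauss d) := by
  unfold stdGauss; fun_prop

lemma lbProp_pos {d : ℕ} {σ : ℝ} (hσ : 0 < σ) (x y : Ed d) : 0 < lbProp σ x y := by
  unfold lbProp; positivity

/-- The Gaussian integral on `ℝ^d` as a lower Lebesgue integral. -/
lemma lintegral_exp_neg_mul_sq_norm (d : ℕ) {b : ℝ} (hb : 0 < b) :
    ∫⁻ x : Ed d, ENNReal.ofReal (exp (-b * ‖x‖ ^ 2)) =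
      ENNReal.ofReal ((π / b) ^ ((d : ℝ) / 2)) := by
  have h := GaussianFourier.integral_rexp_neg_mul_sq_norm (V := Ed d) hb
  rw [finrank_euclideanSpace_fin] at h
  rw [← h, ofReal_integral_eq_lintegral_ofReal]
  · exact .of_integral_ne_zero (by rw [h]; positivity)
  · exact .of_forall fun x => (exp_pos _).le

lemma lintegral_stdGauss (d : ℕ) : ∫⁻ x : Ed d, ENNReal.ofReal (stdGauss d x) = 1 := by
  have h (x : Ed d) : ENNReal.ofReal (stdGauss d x) =
      ENNReal.ofReal ((2 * π) ^ (-(d : ℝ) / 2)) *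
        ENNReal.ofReal (exp (-(1 / 2) * ‖x‖ ^ 2)) := by
    rw [← ENNReal.ofReal_mul (by positivity), stdGauss]
    ring_nf
  simp_rw [h]
  rw [lintegral_const_mul _ (by fun_prop), lintegral_exp_neg_mul_sq_norm d (by norm_num),
    ← ENNReal.ofReal_mul (by positivity), show π / (1 / 2) = 2 * π by ring,
    ← Real.rpow_add (by positivity)]
  simp [neg_div]

lemma lintegral_piMeasure (d : ℕ) (g : Ed d → ℝ≥0∞) :
    ∫⁻ x, g x ∂piMeasure d = ∫⁻ x, ENNReal.ofReal (stdGauss d x) * g x :=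
  lintegral_withDensity_eq_lintegral_mul_non_measurable _
    (continuous_stdGauss d).measurable.ennreal_ofReal (by simp) g

instance isProbabilityMeasure_piMeasure (d : ℕ) : IsProbabilityMeasure (piMeasure d) :=
  ⟨by rw [piMeasure, withDensity_apply _ .univ, setLIntegral_univ, lintegral_stdGauss]⟩

/-- The acceptance-weighted density of the stationary flow from `x` to `y`. -/
lemma lbAcc_mul {d : ℕ} {σ : ℝ} (hσ : 0 < σ) (x y : Ed d) :
    lbAcc d σ x y * lbProp σ x y * stdGauss d x =
      min (stdGauss d x * lbProp σ x y) (stdGauss d y * lbProp σ y x) := by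
  have h : 0 < stdGauss d x * lbProp σ x y := mul_pos (stdGauss_pos d x) (lbProp_pos hσ x y)
  rw [mul_assoc, mul_comm (lbProp σ x y), lbAcc, min_mul_of_nonneg _ _ h.le, one_mul,
    div_mul_cancel₀ _ h.ne']

/-- Sampling from the proposal is an affine image of sampling from the standard Gaussian. -/
lemma lintegral_lbProp_mul (d : ℕ) {σ : ℝ} (hσ : 0 < σ) (x : Ed d) (F : Ed d → ℝ≥0∞)
    (hF : Measurable F) :
    ∫⁻ y, ENNReal.ofReal (lbProp σ x y) * F y =
      ∫⁻ z, ENNReal.ofReal (stdGauss d z) *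
        F ((2 / (2 + σ ^ 2)) • x + √(2 * σ ^ 2 / (2 + σ ^ 2)) • z) := by
  set v : ℝ := 2 * σ ^ 2 / (2 + σ ^ 2) with hv
  have hv0 : 0 < v := by positivity
  have hs : 0 < √v := Real.sqrt_pos.2 hv0
  set a : ℝ := 2 / (2 + σ ^ 2) with ha
  have hmeas : Measurable fun y => ENNReal.ofReal (lbProp σ x y) * F y := by
    have : Continuous fun y => lbProp σ x y := by unfold lbProp; fun_prop
    exact this.measurable.ennreal_ofReal.mul hF
  set G : Ed d → ℝ≥0∞ := fun w => ENNReal.ofReal (lbProp σ x (a • x + w)) * F (a • x + w) with hG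
  have hGm : Measurable G := hmeas.comp (measurable_const_add (a • x))
  have h1 : ∫⁻ y, ENNReal.ofReal (lbProp σ x y) * F y = ∫⁻ w, G w :=
    (lintegral_add_left_eq_self (fun y => ENNReal.ofReal (lbProp σ x y) * F y) (a • x)).symm
  have h2 : ∫⁻ z, G (√v • z) = ENNReal.ofReal (√v ^ d)⁻¹ * ∫⁻ w, G w := by
    rw [← lintegral_map hGm (measurable_const_smul (√v)), Measure.map_addHaar_smul _ hs.ne',
      lintegral_smul_measure, finrank_euclideanSpace_fin, abs_of_pos (by positivity), smul_eq_mul]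
  have h3 (z : Ed d) : ENNReal.ofReal (stdGauss d z) * F (a • x + √v • z) =
      ENNReal.ofReal (√v ^ d) * G (√v • z) := by
    rw [hG]
    dsimp only
    rw [← mul_assoc, ← ENNReal.ofReal_mul (by positivity)]
    congr 2
    rw [lbProp, ← hv, ← ha, add_sub_cancel_left, norm_smul, mul_pow, stdGauss, norm_eq_abs,
      sq_abs, Real.sq_sqrt hv0.le, Real.mul_rpow (by positivity) hv0.le,
      show -(v * ‖z‖ ^ 2) / (2 * v) = -‖z‖ ^ 2 / 2 by field_simp]
    have : √v ^ d * v ^ (-(d : ℝ) / 2) = 1 := by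
      rw [← Real.rpow_natCast, Real.sqrt_eq_rpow, ← Real.rpow_mul hv0.le, ← Real.rpow_add hv0]
      convert Real.rpow_zero v using 2
      ring
    linear_combination (-(2 * π) ^ (-(d : ℝ) / 2) * rexp (-‖z‖ ^ 2 / 2)) * this
  simp_rw [h3]
  rw [lintegral_const_mul' _ _ ENNReal.ofReal_ne_top, h2, ← mul_assoc,
    ← ENNReal.ofReal_mul (by positivity), mul_inv_cancel₀ (by positivity), ENNReal.ofReal_one,
    one_mul, h1]

/-- The pushforward of the target by the proposal has density maximal at the origin. -/
lemma lintegral_stdGauss_mul_lbProp_le (d : ℕ) {σ : ℝ} (hσ : 0 < σ) (x : Ed d) :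
    ∫⁻ y, ENNReal.ofReal (stdGauss d y * lbProp σ y x) ≤
      ENNReal.ofReal ((2 * π) ^ (-(d : ℝ) / 2) *
        (1 + σ ^ 4 / (2 + σ ^ 2) ^ 2) ^ (-(d : ℝ) / 2)) := by
  set c : ℝ := 2 + σ ^ 2 with hc
  have hc0 : 0 < c := by positivity
  set K : ℝ := 1 / 2 + 1 / (c * σ ^ 2) with hK
  have hK0 : 0 < K := by positivity
  set m : ℝ := 1 / (2 * σ ^ 2) / K with hm
  set A : ℝ := (2 * π) ^ (-(d : ℝ) / 2) * (2 * π * (2 * σ ^ 2 / c)) ^ (-(d : ℝ) / 2) with hA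
  have hA0 : 0 < A := by positivity
  have h1 (y : Ed d) : stdGauss d y * lbProp σ y x ≤ A * exp (-K * ‖y - m • x‖ ^ 2) := by
    rw [stdGauss, lbProp, ← hc, mul_mul_mul_comm, ← hA, ← Real.exp_add]
    gcongr
    rw [norm_sub_sq_real, norm_sub_sq_real, norm_smul, norm_smul, inner_smul_right,
      inner_smul_right, real_inner_comm x y, mul_pow, mul_pow, norm_eq_abs, norm_eq_abs, sq_abs,
      sq_abs]
    set t := inner ℝ x y
    have hcoef : 0 ≤ c / (4 * σ ^ 2) - K * m ^ 2 := by
      have : c / (4 * σ ^ 2) - K * m ^ 2 = 1 / (4 * σ ^ 2 * K) * (c / 2) := by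
        rw [hm, hK]; field_simp; ring
      rw [this]; positivity
    have hKm : K * m = 1 / (2 * σ ^ 2) := by rw [hm]; field_simp
    have hx := mul_nonneg hcoef (sq_nonneg ‖x‖)
    have e : -‖y‖ ^ 2 / 2 + -(‖x‖ ^ 2 - 2 * (2 / c * t) + (2 / c) ^ 2 * ‖y‖ ^ 2) /
        (2 * (2 * σ ^ 2 / c)) = -K * ‖y‖ ^ 2 + 2 * (1 / (2 * σ ^ 2)) * t
          - c / (4 * σ ^ 2) * ‖x‖ ^ 2 := by
      rw [hK]; field_simp; ring
    rw [e, ← hKm]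
    linarith
  calc ∫⁻ y, ENNReal.ofReal (stdGauss d y * lbProp σ y x)
      ≤ ∫⁻ y, ENNReal.ofReal A * ENNReal.ofReal (exp (-K * ‖y - m • x‖ ^ 2)) := by
        refine lintegral_mono fun y => ?_
        rw [← ENNReal.ofReal_mul hA0.le]
        exact ENNReal.ofReal_le_ofReal (h1 y)
    _ = ENNReal.ofReal (A * (π / K) ^ ((d : ℝ) / 2)) := by
        rw [lintegral_const_mul' _ _ ENNReal.ofReal_ne_top,
          lintegral_sub_right_eq_self (fun y : Ed d => ENNReal.ofReal (exp (-K * ‖y‖ ^ 2))),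
          lintegral_exp_neg_mul_sq_norm d hK0, ENNReal.ofReal_mul hA0.le]
    _ = _ := by
        congr 1
        rw [hA, mul_assoc]
        congr 1
        have : (π / K) ^ ((d : ℝ) / 2) = (K / π) ^ (-(d : ℝ) / 2) := by
          rw [neg_div, Real.rpow_neg (by positivity), ← Real.inv_rpow (by positivity), inv_div]
        rw [this, ← Real.mul_rpow (by positivity) (by positivity)]
        congr 1
        rw [hK, hc]
        field_simp
        ring

lemma lintegral_coord_sq_lt_top (d : ℕ) (i : Fin d) :
    ∫⁻ x, ENNReal.ofReal (x i ^ 2) ∂piMeasure d < ∞ := by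
  rw [lintegral_piMeasure]
  have h (x : Ed d) : ENNReal.ofReal (stdGauss d x) * ENNReal.ofReal (x i ^ 2) ≤
      ENNReal.ofReal ((2 * π) ^ (-(d : ℝ) / 2) * 4) *
        ENNReal.ofReal (exp (-(1 / 4) * ‖x‖ ^ 2)) := by
    rw [← ENNReal.ofReal_mul (stdGauss_pos d x).le, ← ENNReal.ofReal_mul (by positivity), stdGauss,
      mul_assoc, mul_assoc]
    refine ENNReal.ofReal_le_ofReal (mul_le_mul_of_nonneg_left ?_ (by positivity))
    have h1 : x i ^ 2 ≤ ‖x‖ ^ 2 := by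
      have := PiLp.norm_apply_le x i
      rw [← sq_abs (x i)]
      gcongr
      exact this
    have h2 : ‖x‖ ^ 2 ≤ 4 * exp (‖x‖ ^ 2 / 4) := by
      linarith [Real.add_one_le_exp (‖x‖ ^ 2 / 4)]
    calc exp (-‖x‖ ^ 2 / 2) * x i ^ 2 ≤ exp (-‖x‖ ^ 2 / 2) * (4 * exp (‖x‖ ^ 2 / 4)) := by
          gcongr
          exact h1.trans h2
      _ = 4 * exp (-(1 / 4) * ‖x‖ ^ 2) := by
          rw [mul_left_comm, ← Real.exp_add]
          ring_nf
  refine (lintegral_mono h).trans_lt ?_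
  rw [lintegral_const_mul' _ _ ENNReal.ofReal_ne_top, lintegral_exp_neg_mul_sq_norm d (by norm_num)]
  exact ENNReal.mul_lt_top ENNReal.ofReal_lt_top ENNReal.ofReal_lt_top

lemma lintegral_coord_sq_pos (d : ℕ) (i : Fin d) :
    0 < ∫⁻ x, ENNReal.ofReal (x i ^ 2) ∂piMeasure d := by
  rw [lintegral_piMeasure, pos_iff_ne_zero]
  simp_rw [← ENNReal.ofReal_mul (stdGauss_pos d _).le]
  have hc : Continuous fun x : Ed d => ENNReal.ofReal (stdGauss d x * x i ^ 2) :=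
    ENNReal.continuous_ofReal.comp ((continuous_stdGauss d).mul (by fun_prop))
  rw [Ne, lintegral_eq_zero_iff hc.measurable]
  intro h
  have h0 := congrFun (Continuous.ae_eq_iff_eq volume hc continuous_const |>.1 h)
    (EuclideanSpace.single i 1)
  have := stdGauss_pos d (EuclideanSpace.single i 1)
  simp at h0
  linarith

lemma integral_coord_piMeasure (d : ℕ) (i : Fin d) : ∫ x, x i ∂piMeasure d = 0 := by
  rw [piMeasure, integral_withDensity_eq_integral_toReal_smul
    (continuous_stdGauss d).measurable.ennreal_ofReal (by simp)]
  have h := integral_neg_eq_self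
    (fun x : Ed d => (ENNReal.ofReal (stdGauss d x)).toReal • x i) volume
  simp only [stdGauss, norm_neg, PiLp.neg_apply, smul_neg, integral_neg] at h ⊢
  linarith

lemma lintegral_sub_mul_coord_sq (d : ℕ) (i : Fin d) (u s : ℝ) :
    ∫⁻ z : Ed d, ENNReal.ofReal (stdGauss d z) * ENNReal.ofReal ((u - s * z i) ^ 2) =
      ENNReal.ofReal (u ^ 2) +
        ENNReal.ofReal (s ^ 2) * ∫⁻ x, ENNReal.ofReal (x i ^ 2) ∂piMeasure d := by
  have hπ : Measurable (stdGauss d) := (continuous_stdGauss d).measurable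
  set J := ∫⁻ z : Ed d, ENNReal.ofReal (stdGauss d z) * ENNReal.ofReal ((u - s * z i) ^ 2) with hJ
  have hneg : J =
      ∫⁻ z : Ed d, ENNReal.ofReal (stdGauss d z) * ENNReal.ofReal ((u + s * z i) ^ 2) := by
    rw [hJ, ← lintegral_neg_eq_self]
    simp [stdGauss]
  have hsum : 2 * J = 2 * (ENNReal.ofReal (u ^ 2) +
      ENNReal.ofReal (s ^ 2) * ∫⁻ x, ENNReal.ofReal (x i ^ 2) ∂piMeasure d) := by
    rw [two_mul]
    nth_rw 2 [hneg]
    rw [hJ, ← lintegral_add_left (by fun_prop), lintegral_piMeasure]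
    have (z : Ed d) : ENNReal.ofReal (stdGauss d z) * ENNReal.ofReal ((u - s * z i) ^ 2) +
        ENNReal.ofReal (stdGauss d z) * ENNReal.ofReal ((u + s * z i) ^ 2) =
        2 * (ENNReal.ofReal (u ^ 2) * ENNReal.ofReal (stdGauss d z) +
          ENNReal.ofReal (s ^ 2) * (ENNReal.ofReal (stdGauss d z) * ENNReal.ofReal (z i ^ 2))) := by
      have h0 := (stdGauss_pos d z).le
      generalize z.ofLp i = w
      rw [← ENNReal.ofReal_ofNat 2]
      repeat rw [← ENNReal.ofReal_mul (by positivity)]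
      rw [← ENNReal.ofReal_add (by positivity) (by positivity),
        ← ENNReal.ofReal_add (by positivity) (by positivity), ← ENNReal.ofReal_mul (by positivity)]
      congr 1
      ring
    simp_rw [this]
    rw [lintegral_const_mul' _ _ (by simp), lintegral_add_left (by fun_prop),
      lintegral_const_mul' _ _ ENNReal.ofReal_ne_top, lintegral_const_mul' _ _ ENNReal.ofReal_ne_top,
      lintegral_stdGauss, mul_one]
  exact (ENNReal.mul_right_inj two_ne_zero (by simp)).1 hsum

/-- Testing the spectral gap on a linear function. -/
lemma lbGap_le_linear (d : ℕ) (hd : 1 ≤ d) {σ : ℝ} (hσ : 0 < σ) :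
    lbGap d σ ≤ ENNReal.ofReal ((3 / 2 : ℝ) * σ ^ 2 / (2 + σ ^ 2)) := by
  let i : Fin d := ⟨0, hd⟩
  set I := ∫⁻ x, ENNReal.ofReal (x i ^ 2) ∂piMeasure d with hI
  have hI0 : 0 < I := lintegral_coord_sq_pos d i
  have hI1 : I < ∞ := lintegral_coord_sq_lt_top d i
  refine (iInf₂_le (fun x : Ed d => x i)
    ⟨by fun_prop, hI0, hI1, integral_coord_piMeasure d i⟩).trans ?_
  rw [ENNReal.div_le_iff hI0.ne' hI1.ne]
  set a : ℝ := 2 / (2 + σ ^ 2) with ha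
  set v : ℝ := 2 * σ ^ 2 / (2 + σ ^ 2) with hv
  have hv0 : 0 ≤ v := by positivity
  have h1a : 0 ≤ 1 - a := by
    rw [ha, sub_nonneg, div_le_one (by positivity)]
    nlinarith
  have hinner (x : Ed d) : ∫⁻ y, ENNReal.ofReal
        ((x i - y i) ^ 2 * lbAcc d σ x y * lbProp σ x y * stdGauss d x) ≤
      ENNReal.ofReal (1 - a) ^ 2 * (ENNReal.ofReal (stdGauss d x) * ENNReal.ofReal (x i ^ 2)) +
        ENNReal.ofReal v * I * ENNReal.ofReal (stdGauss d x) := by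
    have hx := (stdGauss_pos d x).le
    calc _ ≤ ∫⁻ y, ENNReal.ofReal (stdGauss d x) *
          (ENNReal.ofReal (lbProp σ x y) * ENNReal.ofReal ((x i - y i) ^ 2)) := by
          refine lintegral_mono fun y => ?_
          have hg := (lbProp_pos hσ x y).le
          dsimp only
          rw [← ENNReal.ofReal_mul hg, ← ENNReal.ofReal_mul hx, mul_assoc, mul_assoc,
            ← mul_assoc (lbAcc d σ x y), lbAcc_mul hσ]
          refine ENNReal.ofReal_le_ofReal ?_
          calc _ ≤ (x i - y i) ^ 2 * (stdGauss d x * lbProp σ x y) := by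
                gcongr
                exact min_le_left _ _
            _ = _ := by ring
      _ = ENNReal.ofReal (stdGauss d x) *
          (ENNReal.ofReal (((1 - a) * x i) ^ 2) + ENNReal.ofReal v * I) := by
          rw [lintegral_const_mul' _ _ ENNReal.ofReal_ne_top,
            lintegral_lbProp_mul d hσ x (fun y => ENNReal.ofReal ((x i - y i) ^ 2)) (by fun_prop),
            ← ha, ← hv]
          have := lintegral_sub_mul_coord_sq d i ((1 - a) * x i) (√v)
          rw [Real.sq_sqrt hv0] at this
          rw [← this]
          congr! 5 with z
          simp
          ring
      _ = _ := by
          rw [mul_pow, ENNReal.ofReal_mul (by positivity), ENNReal.ofReal_pow h1a]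
          ring
  calc lbDirichlet d σ (fun x => x i)
      ≤ (1 / 2) * (ENNReal.ofReal (1 - a) ^ 2 * I + ENNReal.ofReal v * I) := by
        unfold lbDirichlet
        gcongr
        refine (lintegral_mono hinner).trans_eq ?_
        have hπ : Measurable (stdGauss d) := (continuous_stdGauss d).measurable
        rw [lintegral_add_left (by fun_prop), lintegral_const_mul' _ _ (by simp),
          lintegral_const_mul' _ _ (ENNReal.mul_ne_top ENNReal.ofReal_ne_top hI1.ne),
          lintegral_stdGauss, mul_one, ← lintegral_piMeasure]
    _ = ENNReal.ofReal (1 / 2 * ((1 - a) ^ 2 + v)) * I := by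
        rw [← add_mul, ← ENNReal.ofReal_pow h1a, ← ENNReal.ofReal_add (by positivity) hv0,
          ENNReal.ofReal_mul (by norm_num), mul_assoc]
        congr 1
        rw [ENNReal.ofReal_div_of_pos (by norm_num)]
        simp
    _ ≤ _ := by
        gcongr
        have : 3 / 2 * σ ^ 2 / (2 + σ ^ 2) - 1 / 2 * ((1 - a) ^ 2 + v) =
            σ ^ 2 / (2 + σ ^ 2) ^ 2 := by
          rw [ha, hv]; field_simp; ring
        have h0 : 0 ≤ σ ^ 2 / (2 + σ ^ 2) ^ 2 := by positivity
        linarith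

lemma piMeasure_real_le (d : ℕ) {A : Set (Ed d)} (hA : volume A ≠ ∞) :
    (piMeasure d).real A ≤ (2 * π) ^ (-(d : ℝ) / 2) * volume.real A := by
  have hk : 0 ≤ (2 * π) ^ (-(d : ℝ) / 2) := by positivity
  rw [← ENNReal.ofReal_le_ofReal_iff (by positivity), ENNReal.ofReal_mul hk, ofReal_measureReal,
    ofReal_measureReal hA, piMeasure, withDensity_apply' _ A, ← setLIntegral_const]
  refine lintegral_mono fun x => ENNReal.ofReal_le_ofReal ?_
  rw [stdGauss]
  refine mul_le_of_le_one_right hk (Real.exp_le_one_iff.2 ?_)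
  linarith [sq_nonneg ‖x‖]

lemma le_piMeasure_real_ball (d : ℕ) (r : ℝ) :
    (2 * π) ^ (-(d : ℝ) / 2) * exp (-r ^ 2 / 2) * volume.real (Metric.ball (0 : Ed d) r) ≤
      (piMeasure d).real (Metric.ball 0 r) := by
  rw [← ENNReal.ofReal_le_ofReal_iff measureReal_nonneg, ENNReal.ofReal_mul (by positivity),
    ofReal_measureReal, ofReal_measureReal measure_ball_lt_top.ne, piMeasure,
    withDensity_apply' _ _, ← setLIntegral_const]
  refine setLIntegral_mono' measurableSet_ball fun x hx => ENNReal.ofReal_le_ofReal ?_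
  rw [mem_ball_zero_iff] at hx
  rw [stdGauss]
  gcongr

lemma lintegral_centered_indicator_sq {α : Type*} [MeasurableSpace α] (μ : Measure α)
    [IsProbabilityMeasure μ] {A : Set α} (hA : MeasurableSet A) :
    ∫⁻ x, ENNReal.ofReal ((A.indicator 1 x - μ.real A) ^ 2) ∂μ =
      ENNReal.ofReal (μ.real A * (1 - μ.real A)) := by
  set p := μ.real A
  have h (x : α) : (A.indicator 1 x - p) ^ 2 = A.indicator (fun _ => 1 - 2 * p) x + p ^ 2 := by
    by_cases hx : x ∈ A <;> simp [hx]
    ring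
  have hi : Integrable (A.indicator fun _ => 1 - 2 * p) μ := (integrable_const _).indicator hA
  rw [← ofReal_integral_eq_lintegral_ofReal _ (.of_forall fun x => sq_nonneg _)]
  · simp_rw [h]
    rw [integral_add hi (integrable_const _), integral_indicator hA, setIntegral_const]
    simp only [integral_const, smul_eq_mul, probReal_univ]
    congr 1
    ring
  · simp_rw [h]
    exact hi.add (integrable_const _)

/-- The flow out of a set is at most its volume times the maximal density of one proposal step. -/
lemma lbDirichlet_indicator_le (d : ℕ) {σ : ℝ} (hσ : 0 < σ) {A : Set (Ed d)}
    (hA : MeasurableSet A) (p : ℝ) :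
    lbDirichlet d σ (fun x => A.indicator 1 x - p) ≤
      ENNReal.ofReal ((2 * π) ^ (-(d : ℝ) / 2) *
        (1 + σ ^ 4 / (2 + σ ^ 2) ^ 2) ^ (-(d : ℝ) / 2)) * volume A := by
  set D := ENNReal.ofReal ((2 * π) ^ (-(d : ℝ) / 2) *
        (1 + σ ^ 4 / (2 + σ ^ 2) ^ 2) ^ (-(d : ℝ) / 2))
  set q : Ed d → Ed d → ℝ≥0∞ :=
    fun x y => A.indicator 1 x * ENNReal.ofReal (stdGauss d y * lbProp σ y x) with hq
  have hqm : Measurable (Function.uncurry q) := by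
    have h1 : Continuous fun z : Ed d × Ed d => stdGauss d z.2 * lbProp σ z.2 z.1 := by
      unfold stdGauss lbProp; fun_prop
    exact ((measurable_one.indicator hA).comp measurable_fst).mul h1.measurable.ennreal_ofReal
  have hq1 : ∫⁻ x, ∫⁻ y, q x y ≤ D * volume A := by
    rw [← setLIntegral_const, ← lintegral_indicator hA]
    refine lintegral_mono fun x => ?_
    by_cases hx : x ∈ A
    · simpa [hq, hx] using lintegral_stdGauss_mul_lbProp_le d hσ x
    · simp [hq, hx]
  have hq2 : ∫⁻ x, ∫⁻ y, q y x = ∫⁻ x, ∫⁻ y, q x y :=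
    (lintegral_lintegral_swap hqm.aemeasurable).symm
  have hpt (x y : Ed d) : ENNReal.ofReal (((A.indicator 1 x - p) - (A.indicator 1 y - p)) ^ 2 *
      lbAcc d σ x y * lbProp σ x y * stdGauss d x) ≤ q x y + q y x := by
    rw [mul_assoc, mul_assoc, ← mul_assoc (lbAcc d σ x y), lbAcc_mul hσ, hq,
      sub_sub_sub_cancel_right]
    by_cases hx : x ∈ A <;> by_cases hy : y ∈ A <;> simp [hx, hy]
  calc lbDirichlet d σ (fun x => A.indicator 1 x - p)
      ≤ 1 / 2 * ∫⁻ x, ∫⁻ y, (q x y + q y x) := by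
        unfold lbDirichlet
        gcongr with x y
        exact hpt x y
    _ = 1 / 2 * (2 * ∫⁻ x, ∫⁻ y, q x y) := by
        have (x : Ed d) : ∫⁻ y, (q x y + q y x) = (∫⁻ y, q x y) + ∫⁻ y, q y x :=
          lintegral_add_left (hqm.comp measurable_prodMk_left) _
        simp_rw [this]
        rw [lintegral_add_left (by exact hqm.lintegral_prod_right'), hq2, two_mul]
    _ ≤ _ := by
        rw [← mul_assoc, one_div, ENNReal.inv_mul_cancel two_ne_zero (by simp), one_mul]
        exact hq1

/-- Testing the spectral gap on the centered indicator of a ball at the origin. -/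
lemma lbGap_le_ball (d : ℕ) {σ : ℝ} (hσ : 0 < σ) {r : ℝ} (hr : 0 < r)
    (hV : (2 * π) ^ (-(d : ℝ) / 2) * volume.real (Metric.ball (0 : Ed d) r) < 1) :
    lbGap d σ ≤ ENNReal.ofReal ((1 + σ ^ 4 / (2 + σ ^ 2) ^ 2) ^ (-(d : ℝ) / 2) *
      exp (r ^ 2 / 2) /
        (1 - (2 * π) ^ (-(d : ℝ) / 2) * volume.real (Metric.ball (0 : Ed d) r))) := by
  set A := Metric.ball (0 : Ed d) r with hA
  have hAm : MeasurableSet A := measurableSet_ball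
  have hAt : volume A ≠ ∞ := measure_ball_lt_top.ne
  set k : ℝ := (2 * π) ^ (-(d : ℝ) / 2) with hk
  set C : ℝ := (1 + σ ^ 4 / (2 + σ ^ 2) ^ 2) ^ (-(d : ℝ) / 2)
  set V := volume.real A
  set p := (piMeasure d).real A with hp
  have hk0 : 0 < k := by positivity
  have hC0 : 0 ≤ C := by positivity
  have hV0 : 0 < V := ENNReal.toReal_pos (Metric.measure_ball_pos _ _ hr).ne' hAt
  have hpV : p ≤ k * V := piMeasure_real_le d hAt
  have hVp : k * exp (-r ^ 2 / 2) * V ≤ p := le_piMeasure_real_ball d r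
  have hp0 : 0 < p := lt_of_lt_of_le (by positivity) hVp
  have hvar := lintegral_centered_indicator_sq (piMeasure d) hAm
  have hvar0 : 0 < ENNReal.ofReal (p * (1 - p)) :=
    ENNReal.ofReal_pos.2 (mul_pos hp0 (by linarith))
  have hmean : ∫ x, (A.indicator 1 x - p) ∂piMeasure d = 0 := by
    have hi : Integrable (A.indicator (1 : Ed d → ℝ)) (piMeasure d) :=
      (integrable_const (1 : ℝ)).indicator hAm
    rw [integral_sub hi (integrable_const _), integral_indicator_one hAm]
    simp [hp]
  refine (iInf₂_le (fun x => A.indicator 1 x - p)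
    ⟨(measurable_one.indicator hAm).sub_const p, hvar.symm ▸ hvar0,
      hvar.symm ▸ ENNReal.ofReal_lt_top, hmean⟩).trans ?_
  rw [hvar, ENNReal.div_le_iff hvar0.ne' ENNReal.ofReal_ne_top]
  refine (lbDirichlet_indicator_le d hσ hAm p).trans ?_
  rw [← ofReal_measureReal hAt, ← ENNReal.ofReal_mul (by positivity),
    ← ENNReal.ofReal_mul (div_nonneg (by positivity) (by linarith))]
  refine ENNReal.ofReal_le_ofReal ?_
  have hkV : k * V ≤ exp (r ^ 2 / 2) * p := by
    calc k * V = exp (r ^ 2 / 2) * (k * exp (-r ^ 2 / 2) * V) := by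
          rw [neg_div, Real.exp_neg]
          field_simp
      _ ≤ _ := by gcongr
  calc k * C * V = C * (k * V) := by ring
    _ ≤ C * (exp (r ^ 2 / 2) * p) := by gcongr
    _ ≤ C * (exp (r ^ 2 / 2) * p) * ((1 - p) / (1 - k * V)) :=
        le_mul_of_one_le_right (by positivity) ((one_le_div (by linarith)).2 (by linarith))
    _ = _ := by ring

/-- The acceptance rate at the origin bounds the spectral gap. -/
lemma lbGap_le_acceptance (d : ℕ) (hd : 1 ≤ d) {σ : ℝ} (hσ : 0 < σ) :
    lbGap d σ ≤ ENNReal.ofReal ((1 + σ ^ 4 / (2 + σ ^ 2) ^ 2) ^ (-(d : ℝ) / 2)) := by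
  set k : ℝ := (2 * π) ^ (-(d : ℝ) / 2) with hk
  set C : ℝ := (1 + σ ^ 4 / (2 + σ ^ 2) ^ 2) ^ (-(d : ℝ) / 2)
  set V₁ := volume.real (Metric.ball (0 : Ed d) 1)
  have hV {r : ℝ} (hr : 0 < r) : volume.real (Metric.ball (0 : Ed d) r) = r ^ d * V₁ := by
    rw [Measure.real, Measure.addHaar_ball_of_pos _ _ hr, finrank_euclideanSpace_fin,
      ENNReal.toReal_mul, ENNReal.toReal_ofReal (by positivity)]
    rfl
  have hd0 : d ≠ 0 := by omega
  have hmass : Tendsto (fun r : ℝ => k * (r ^ d * V₁)) (𝓝[>] 0) (𝓝 0) := by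
    have : Continuous fun r : ℝ => k * (r ^ d * V₁) := by fun_prop
    simpa [hd0] using (this.tendsto 0).mono_left nhdsWithin_le_nhds
  have hexp : Tendsto (fun r : ℝ => C * exp (r ^ 2 / 2)) (𝓝[>] 0) (𝓝 C) := by
    have : Continuous fun r : ℝ => C * exp (r ^ 2 / 2) := by fun_prop
    simpa using (this.tendsto 0).mono_left nhdsWithin_le_nhds
  have hlim : Tendsto (fun r : ℝ => C * exp (r ^ 2 / 2) / (1 - k * (r ^ d * V₁)))
      (𝓝[>] 0) (𝓝 C) := by
    have h := hexp.div (hmass.const_sub 1) (by simp)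
    rwa [sub_zero, div_one] at h
  refine ge_of_tendsto (ENNReal.tendsto_ofReal hlim) ?_
  filter_upwards [self_mem_nhdsWithin, hmass.eventually_lt_const one_pos] with r hr hlt
  rw [← hV hr] at hlt ⊢
  exact lbGap_le_ball d hσ hr hlt

end SpectralGap

/-- Spectral gap upper bound for the locally balanced ideal kernel:
`γ(P_∞) ≤ min{(3/2) σ²/(2+σ²), (1 + σ⁴/(2+σ²)²)^{-d/2}}`. -/
theorem lb_ideal_gap_upper_bound
    (d : ℕ) (hd : 1 ≤ d) (σ : ℝ) (hσ : 0 < σ) :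
    lbGap d σ ≤
      ENNReal.ofReal
        (min ((3 / 2 : ℝ) * σ ^ 2 / (2 + σ ^ 2))
          ((1 + σ ^ 4 / (2 + σ ^ 2) ^ 2) ^ (-(d : ℝ) / 2))) := by
  rw [ENNReal.ofReal_min]
  exact le_min (lbGap_le_linear d hd hσ) (lbGap_le_acceptance d hd hσ)

end
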